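/- Let G be a finite group and let B be a Rota–Baxter operator on G such that (i) all elements of R := Im(B) ∩ Im(B̃) commute with each other, and (ii) G = ker(B)·Im(B) is an exact factorization (ker(B) ∩ Im(B) = {e} and every element of G is a product k·l with k ∈ ker(B), l ∈ Im(B)). Then B̃ restricted to Im(B) is a homomorphism onto R; that is, B̃(x·y) = B̃(x)·B̃(y) for all x, y ∈ Im(B), and the image B̃(Im(B)) equals R. -/

import Mathlib

/-- A Rota–Baxter operator of weight 1 on a group. -/
def IsRotaBaxter {G : Type*} [Group G] (B : G → G) : Prop :=
  ∀ g h : G, B g * B h = B (g * B g * h * (B g)⁻¹)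

/-- A splitting Rota–Baxter operator: comes from an exact factorization G = HL. -/
def IsSplitting {G : Type*} [Group G] (B : G → G) : Prop :=
  ∃ H L : Subgroup G, H ⊓ L = ⊥ ∧ (∀ g : G, ∃ h ∈ H, ∃ l ∈ L, g = h * l) ∧
    (∀ h ∈ H, ∀ l ∈ L, B (h * l) = l⁻¹)

/-- The companion Rota–Baxter operator B̃(g) = g⁻¹ · B(g⁻¹). -/
def tilde {G : Type*} [Group G] (B : G → G) : G → G := fun g => g⁻¹ * B g⁻¹

namespace IsRotaBaxter

variable {G : Type*} [Group G] {B : G → G}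

theorem map_one (hB : IsRotaBaxter B) : B 1 = 1 := by
  simpa using hB 1 1

/-- The range of a Rota–Baxter operator, as a subgroup. -/
def rangeSubgroup (hB : IsRotaBaxter B) : Subgroup G where
  carrier := Set.range B
  mul_mem' := by
    rintro _ _ ⟨a, rfl⟩ ⟨b, rfl⟩
    exact ⟨_, (hB a b).symm⟩
  one_mem' := ⟨1, hB.map_one⟩
  inv_mem' := by
    rintro _ ⟨a, rfl⟩
    refine ⟨(B a)⁻¹ * a⁻¹ * B a, eq_inv_of_mul_eq_one_right ?_⟩
    rw [hB, ← hB.map_one]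
    congr 1
    group

/-- The Cayley transform `B a ↦ a * B a` of a bijective Rota–Baxter operator. -/
noncomputable def cayley (hB : IsRotaBaxter B) (hbij : Function.Bijective B) : G →* G :=
  MonoidHom.mk' (fun y => (Equiv.ofBijective B hbij).symm y * y) (by
    intro y z
    obtain ⟨a, rfl⟩ := hbij.2 y
    obtain ⟨b, rfl⟩ := hbij.2 z
    rw [hB a b]
    simp only [Equiv.ofBijective_symm_apply_apply]
    rw [← hB a b]
    group)

theorem cayley_apply (hB : IsRotaBaxter B) (hbij : Function.Bijective B) (a : G) :
    hB.cayley hbij (B a) = a * B a := by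
  simp [cayley]

/-- If the values of the companion of a bijective Rota–Baxter operator commute, then the companion
is multiplicative. -/
theorem tilde_mul (hB : IsRotaBaxter B) (hbij : Function.Bijective B)
    (hcomm : ∀ x y, tilde B x * tilde B y = tilde B y * tilde B x) (x y : G) :
    tilde B (x * y) = tilde B x * tilde B y := by
  set φ := hB.cayley hbij
  have tilde_eq (x : G) : tilde B x = φ (B x⁻¹) := (hB.cayley_apply hbij x⁻¹).symm
  have comm (u v : G) : φ u * φ v = φ v * φ u := by
    obtain ⟨a, rfl⟩ := hbij.2 u
    obtain ⟨b, rfl⟩ := hbij.2 v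
    simpa [tilde_eq] using hcomm a⁻¹ b⁻¹
  have map_tilde (x : G) : φ x * φ (tilde B x) = tilde B x := by
    rw [← _root_.map_mul]
    simpa [tilde] using (tilde_eq x).symm
  obtain ⟨w, hw⟩ := hbij.2 (x * y * (tilde B x * tilde B y))
  have hφ : φ (B w) = tilde B x * tilde B y := by
    calc φ (B w) = φ x * (φ y * φ (tilde B x)) * φ (tilde B y) := by
          rw [hw]; simp only [_root_.map_mul, mul_assoc]
      _ = (φ x * φ (tilde B x)) * (φ y * φ (tilde B y)) := by
          rw [comm y]; simp only [mul_assoc]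
      _ = tilde B x * tilde B y := by rw [map_tilde, map_tilde]
  have hw' : w = (x * y)⁻¹ := by
    have h := hB.cayley_apply hbij w
    rw [show hB.cayley hbij (B w) = _ from hφ, hw, ← mul_assoc] at h
    exact eq_inv_of_mul_eq_one_left (right_eq_mul.mp h)
  rw [tilde_eq, ← hw', hφ]

end IsRotaBaxter

/-- If all elements of R = Im(B) ∩ Im(B̃) commute and G = ker(B)·Im(B) is an exact
factorization, then B̃ restricted to Im(B) is a homomorphism onto R. -/
theorem stmt13 {G : Type*} [Group G] [Finite G] (B : G → G) (hB : IsRotaBaxter B)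
    (hcomm : ∀ a ∈ Set.range B ∩ Set.range (tilde B),
      ∀ b ∈ Set.range B ∩ Set.range (tilde B), a * b = b * a)
    (htriv : ∀ g : G, B g = 1 → g ∈ Set.range B → g = 1)
    (hfact : ∀ g : G, ∃ k, B k = 1 ∧ ∃ l ∈ Set.range B, g = k * l) :
    (∀ x ∈ Set.range B, ∀ y ∈ Set.range B, tilde B (x * y) = tilde B x * tilde B y) ∧
    tilde B '' Set.range B = Set.range B ∩ Set.range (tilde B) := by
  let L := hB.rangeSubgroup
  let C : L → L := fun x => ⟨B x, x, rfl⟩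
  have hC : IsRotaBaxter C := fun g h => Subtype.ext (hB g h)
  have hsurj : Function.Surjective C := by
    rintro ⟨_, g, rfl⟩
    obtain ⟨k, hk, l, hl, rfl⟩ := hfact g
    refine ⟨⟨l, hl⟩, Subtype.ext ?_⟩
    simpa [hk] using hB k l
  have hbij : Function.Bijective C := ⟨Finite.injective_iff_surjective.mpr hsurj, hsurj⟩
  have hmem (x : L) : tilde B x ∈ Set.range B ∩ Set.range (tilde B) :=
    ⟨(tilde C x).2, x, rfl⟩
  have hmul := hC.tilde_mul hbij fun x y => Subtype.ext (hcomm _ (hmem x) _ (hmem y))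
  refine ⟨fun x hx y hy => congrArg Subtype.val (hmul ⟨x, hx⟩ ⟨y, hy⟩), ?_⟩
  ext r
  constructor
  · rintro ⟨x, hx, rfl⟩
    exact hmem ⟨x, hx⟩
  · rintro ⟨hr, g, rfl⟩
    have hg : g⁻¹ ∈ L := (L.mul_mem_cancel_right ⟨g⁻¹, rfl⟩).mp hr
    exact ⟨g, L.inv_mem_iff.mp hg, rfl⟩
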